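/- Let 𝒜 be an abelian category, ℋ a hereditary abelian category, and F : D^b(𝒜) → D^b(ℋ) a triangulated equivalence; for each indecomposable Q of 𝒜 write F(Q[0]) ≅ f(Q)[n(Q)] with f(Q) an indecomposable of ℋ and n(Q) ∈ ℤ. If r ≥ 1, ε = (ε₀,…,ε_{r−1}) ∈ {+1,−1}^r, Q₀ is an indecomposable of 𝒜, and Q is an indecomposable of 𝒜 admitting an ε-path from Q₀ to Q, then n(Q₀) − r₋ ≤ n(Q) ≤ n(Q₀) + r₊, where r₊ is the number of indices i with ε_i = +1 and r₋ is the number with ε_i = −1. -/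

import Mathlib

/-!
Statement 1: bounds on `n(Q)` along an ε-path.
-/

open CategoryTheory CategoryTheory.Limits

universe w w' v u v' u'

namespace PiecewiseHereditaryPaper

variable (𝒜 : Type u) [Category.{v} 𝒜] [Abelian 𝒜] [HasDerivedCategory.{w} 𝒜]

/-- `Ext^d(X,Y) ≠ 0`, where `Ext^d` is computed as `Hom_{D(𝒜)}(X[0], Y[0][d])`. -/
def extNonzero (X Y : 𝒜) (d : ℤ) : Prop :=
  ∃ g : (DerivedCategory.singleFunctor 𝒜 0).obj X ⟶
      (((DerivedCategory.singleFunctor 𝒜 0).obj Y)⟦d⟧), g ≠ 0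

/-- An abelian category is hereditary if `Ext^d` vanishes for all `d ≥ 2`. -/
def Hereditary : Prop := ∀ (X Y : 𝒜) (d : ℕ), 2 ≤ d → ¬ extNonzero 𝒜 X Y (d : ℤ)

/-- An `ε`-path from `Q` to `Q'` in the graph `G(𝒜)` of indecomposables of `𝒜`. -/
def EpsPath {r : ℕ} (ε : Fin r → ℤ) (Q Q' : 𝒜) : Prop :=
  ∃ c : Fin (r + 1) → 𝒜,
    c 0 = Q ∧ c (Fin.last r) = Q' ∧ (∀ i, Indecomposable (c i)) ∧
    ∀ i : Fin r,
      (ε i = 1 → ∃ g : c i.castSucc ⟶ c i.succ, g ≠ 0) ∧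
      (ε i = -1 → ∃ g : c i.succ ⟶ c i.castSucc, g ≠ 0)

variable (ℋ : Type u') [Category.{v'} ℋ] [Abelian ℋ] [HasDerivedCategory.{w'} ℋ]

theorem hom_shift_zero_of_gt (X Y : ℋ) (a b : ℤ) (hab : b < a)
    (g : ((DerivedCategory.singleFunctor ℋ 0).obj X)⟦a⟧ ⟶
      ((DerivedCategory.singleFunctor ℋ 0).obj Y)⟦b⟧) : g = 0 := by
  have h1 := DerivedCategory.TStructure.t.isLE_shift
    ((DerivedCategory.singleFunctor ℋ 0).obj X) 0 a (-a) (by lia)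
  have h2 := DerivedCategory.TStructure.t.isGE_shift
    ((DerivedCategory.singleFunctor ℋ 0).obj Y) 0 b (-b) (by lia)
  exact DerivedCategory.TStructure.t.zero_of_isLE_of_isGE g (-a) (-b) (by lia) h1 h2

theorem hom_shift_zero_of_hereditary (hH : Hereditary ℋ) (X Y : ℋ) (a b : ℤ) (hab : a + 2 ≤ b)
    (g : ((DerivedCategory.singleFunctor ℋ 0).obj X)⟦a⟧ ⟶
      ((DerivedCategory.singleFunctor ℋ 0).obj Y)⟦b⟧) : g = 0 := by
  obtain ⟨d, hd⟩ := Int.eq_ofNat_of_zero_le (show 0 ≤ b - a by lia)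
  have e := (shiftFunctorAdd' (DerivedCategory ℋ) (d : ℤ) a b (by lia)).app
    ((DerivedCategory.singleFunctor ℋ 0).obj Y)
  obtain ⟨p, hp⟩ := (shiftFunctor (DerivedCategory ℋ) a).map_surjective (g ≫ e.hom)
  have hp0 : p = 0 := by
    by_contra hne
    exact hH X Y d (by lia) ⟨p, hne⟩
  rw [hp0, Functor.map_zero] at hp
  rw [← cancel_mono e.hom, ← hp, zero_comp]

theorem n_step (hH : Hereditary ℋ)
    (F : DerivedCategory 𝒜 ⥤ DerivedCategory ℋ) [F.IsEquivalence]
    (f : 𝒜 → ℋ) (n : 𝒜 → ℤ) (Q Q' : 𝒜)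
    (e : F.obj ((DerivedCategory.singleFunctor 𝒜 0).obj Q) ≅
        (((DerivedCategory.singleFunctor ℋ 0).obj (f Q))⟦n Q⟧))
    (e' : F.obj ((DerivedCategory.singleFunctor 𝒜 0).obj Q') ≅
        (((DerivedCategory.singleFunctor ℋ 0).obj (f Q'))⟦n Q'⟧))
    (g : Q ⟶ Q') (hg : g ≠ 0) : n Q ≤ n Q' ∧ n Q' ≤ n Q + 1 := by
  have key : e.inv ≫ F.map ((DerivedCategory.singleFunctor 𝒜 0).map g) ≫ e'.hom ≠ 0 := by
    intro h
    apply hg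
    apply (DerivedCategory.singleFunctor 𝒜 0).map_injective
    apply F.map_injective
    rw [← cancel_epi e.inv, ← cancel_mono e'.hom, Category.assoc, h]
    simp
  constructor
  · by_contra hlt
    exact key (hom_shift_zero_of_gt ℋ _ _ _ _ (by lia) _)
  · by_contra hlt
    exact key (hom_shift_zero_of_hereditary ℋ hH _ _ _ _ (by lia) _)

theorem path_bound (r : ℕ) (ε : Fin r → ℤ) (m : Fin (r + 1) → ℤ)
    (h : ∀ i : Fin r,
      (ε i = 1 ∧ m i.castSucc ≤ m i.succ ∧ m i.succ ≤ m i.castSucc + 1) ∨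
      (ε i = -1 ∧ m i.succ ≤ m i.castSucc ∧ m i.castSucc ≤ m i.succ + 1)) :
    m 0 - (Finset.univ.filter fun i => ε i = -1).card ≤ m (Fin.last r) ∧
      m (Fin.last r) ≤ m 0 + (Finset.univ.filter fun i => ε i = 1).card := by
  induction r with
  | zero => simp
  | succ r ih =>
    have ih' := ih (fun i => ε i.castSucc) (fun i => m i.castSucc) (fun i => h i.castSucc)
    have hl := h (Fin.last r)
    simp only [Finset.card_filter, Fin.sum_univ_castSucc, Fin.succ_last, Fin.castSucc_zero] at *
    push_cast at *
    rcases hl with ⟨h1, h2, h3⟩ | ⟨h1, h2, h3⟩ <;> simp only [h1] <;>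
      norm_num [Finset.sum_boole] at ih' ⊢ <;>
      simp only [Nat.succ_eq_add_one] at h2 h3 <;> constructor <;> linarith [ih'.1, ih'.2]

theorem n_bounds_along_epsPath
    (hH : Hereditary ℋ)
    (F : DerivedCategory 𝒜 ⥤ DerivedCategory ℋ)
    [F.IsEquivalence] [F.CommShift ℤ] [F.IsTriangulated]
    (f : 𝒜 → ℋ) (n : 𝒜 → ℤ)
    (hfn : ∀ Q : 𝒜, Indecomposable Q → Indecomposable (f Q) ∧
      Nonempty (F.obj ((DerivedCategory.singleFunctor 𝒜 0).obj Q) ≅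
        (((DerivedCategory.singleFunctor ℋ 0).obj (f Q))⟦n Q⟧)))
    (r : ℕ) (hr : 1 ≤ r) (ε : Fin r → ℤ) (hε : ∀ i, ε i = 1 ∨ ε i = -1)
    (Q₀ Q : 𝒜) (hQ₀ : Indecomposable Q₀) (hQ : Indecomposable Q)
    (hpath : EpsPath 𝒜 ε Q₀ Q) :
    n Q₀ - (Finset.univ.filter fun i => ε i = -1).card ≤ n Q ∧
      n Q ≤ n Q₀ + (Finset.univ.filter fun i => ε i = 1).card := by
  obtain ⟨c, rfl, rfl, hc, hstep⟩ := hpath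
  refine path_bound r ε (fun i => n (c i)) (fun i => ?_)
  obtain ⟨e⟩ := (hfn _ (hc i.castSucc)).2
  obtain ⟨e'⟩ := (hfn _ (hc i.succ)).2
  rcases hε i with h | h
  · obtain ⟨g, hg⟩ := (hstep i).1 h
    exact Or.inl ⟨h, n_step 𝒜 ℋ hH F f n _ _ e e' g hg⟩
  · obtain ⟨g, hg⟩ := (hstep i).2 h
    exact Or.inr ⟨h, n_step 𝒜 ℋ hH F f n _ _ e' e g hg⟩

end PiecewiseHereditaryPaper
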